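/- Define, for 1 < α < 2 and t > 0, ψ(t) = E_{α,1}(i^{-α} t)² − i^{-α} t · E_{α,2}(i^{-α} t) · E_{α,α}(i^{-α} t), where i^{-α} = exp(-iπα/2). Then there exists R > 0 such that ψ(t) ≠ 0 for all t > R, and the set {t > 0 : ψ(t) = 0} is finite. -/

import Mathlib

open Complex Real

/-- The Mittag-Leffler function `E_{α,β}(z) = ∑ zⁿ / Γ(αn+β)`. -/
noncomputable def mlE (α β : ℝ) (z : ℂ) : ℂ :=
  ∑' n : ℕ, z ^ n / Complex.Gamma ((α * n + β : ℝ) : ℂ)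

/-- The Wronskian-type determinant for the backward problem, `1 < α < 2`. -/
noncomputable def psiML (α : ℝ) (t : ℝ) : ℂ :=
  mlE α 1 (Complex.exp (-Complex.I * Real.pi * α / 2) * t) ^ 2 -
    Complex.exp (-Complex.I * Real.pi * α / 2) * t *
      mlE α 2 (Complex.exp (-Complex.I * Real.pi * α / 2) * t) *
      mlE α α (Complex.exp (-Complex.I * Real.pi * α / 2) * t)


open MeasureTheory Set Filter Topology

lemma ml_inv_Gamma_le {x T : ℝ} (hx : 0 < x) (hT : 0 < T) :
    1 / Real.Gamma x ≤ x * T ^ (-x) * Real.exp T := by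
  have h1 : T ^ x * Real.exp (-T) ≤ Real.Gamma (x + 1) := by
    rw [Real.Gamma_eq_integral (by linarith)]
    have hI := Real.GammaIntegral_convergent (s := x + 1) (by linarith)
    calc T ^ x * Real.exp (-T) = ∫ t in Ioi T, T ^ x * Real.exp (-t) := by
          rw [integral_const_mul, integral_exp_neg_Ioi]
      _ ≤ ∫ t in Ioi T, Real.exp (-t) * t ^ (x + 1 - 1) := by
          refine setIntegral_mono_on ((integrableOn_exp_neg_Ioi T).const_mul _)
            (hI.mono_set (Ioi_subset_Ioi hT.le)) measurableSet_Ioi ?_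
          intro t ht
          rw [mul_comm]
          have : T ^ x ≤ t ^ x := Real.rpow_le_rpow hT.le (le_of_lt ht) hx.le
          simp only [add_sub_cancel_right]
          gcongr
      _ ≤ _ := by
          refine setIntegral_mono_set hI ?_ (Ioi_subset_Ioi hT.le).eventuallyLE
          filter_upwards [ae_restrict_mem measurableSet_Ioi] with t ht
          have : (0:ℝ) < t := ht
          simp only [Pi.zero_apply]
          positivity
  rw [Real.Gamma_add_one hx.ne'] at h1
  have hG := Real.Gamma_pos_of_pos hx
  rw [div_le_iff₀ hG]
  have h2 : T ^ (-x) * Real.exp T * (T ^ x * Real.exp (-T)) = 1 := by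
    rw [Real.rpow_neg hT.le, Real.exp_neg]
    have := (Real.rpow_pos_of_pos hT x).ne'
    have := (Real.exp_pos T).ne'
    field_simp
  calc (1:ℝ) = T ^ (-x) * Real.exp T * (T ^ x * Real.exp (-T)) := h2.symm
    _ ≤ T ^ (-x) * Real.exp T * (x * Real.Gamma x) := by gcongr
    _ = _ := by ring

lemma ml_norm_Gamma {x : ℝ} (hx : 0 < x) : ‖Complex.Gamma (x : ℂ)‖ = Real.Gamma x := by
  rw [Complex.Gamma_ofReal, Complex.norm_real, Real.norm_eq_abs, abs_of_pos (Real.Gamma_pos_of_pos hx)]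

/-- summability of linear times geometric -/
lemma ml_summable_lin {a b r : ℝ} (hr0 : 0 ≤ r) (hr : r < 1) :
    Summable fun n : ℕ => (a * n + b) * r ^ n := by
  have h1 := summable_pow_mul_geometric_of_norm_lt_one 1 (r := r) (by rwa [Real.norm_eq_abs, abs_of_nonneg hr0])
  have h2 := summable_geometric_of_lt_one hr0 hr
  refine ((h1.mul_left a).add (h2.mul_left b)).congr fun n => ?_
  simp; ring

lemma ml_rpow_lin {α β T : ℝ} (hT : 0 < T) (n : ℕ) :
    T ^ (-(α * n + β)) = T ^ (-β) * (T ^ (-α)) ^ n := by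
  rw [← Real.rpow_natCast, ← Real.rpow_mul hT.le, ← Real.rpow_add hT]; congr 1; ring

lemma ml_term_bound {α β T r : ℝ} (hα : 0 < α) (hβ : 0 < β) (hT : 0 < T) {z : ℂ} (hz : ‖z‖ ≤ r) (n : ℕ) :
    ‖z ^ n / Complex.Gamma ((α * n + β : ℝ) : ℂ)‖ ≤
      (T ^ (-β) * Real.exp T) * ((α * n + β) * (r * T ^ (-α)) ^ n) := by
  have hx : 0 < α * n + β := by positivity
  have h := ml_inv_Gamma_le hx hT
  have hr : 0 ≤ r := (norm_nonneg z).trans hz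
  rw [norm_div, norm_pow, ml_norm_Gamma hx, div_eq_mul_one_div]
  calc ‖z‖ ^ n * (1 / Real.Gamma (α * n + β)) ≤ r ^ n * ((α * n + β) * T ^ (-(α * n + β)) * Real.exp T) := by
        gcongr
    _ = _ := by rw [ml_rpow_lin hT, mul_pow]; ring

lemma ml_exists_T {α r : ℝ} (hα : 0 < α) (hr : 0 ≤ r) : ∃ T : ℝ, 0 < T ∧ r * T ^ (-α) < 1 := by
  refine ⟨(r + 1) ^ (1 / α), by positivity, ?_⟩
  rw [← Real.rpow_mul (by positivity)]
  have : 1 / α * -α = -1 := by field_simp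
  rw [this, Real.rpow_neg_one, ← div_eq_mul_inv, div_lt_one (by positivity)]
  linarith

lemma ml_summable {α β : ℝ} (hα : 0 < α) (hβ : 0 < β) (z : ℂ) :
    Summable fun n : ℕ => z ^ n / Complex.Gamma ((α * n + β : ℝ) : ℂ) := by
  obtain ⟨T, hT, h⟩ := ml_exists_T hα (norm_nonneg z)
  refine Summable.of_norm_bounded ?_ (fun n => ml_term_bound hα hβ hT le_rfl n)
  exact (ml_summable_lin (by positivity) h).mul_left _

lemma ml_differentiable {α β : ℝ} (hα : 0 < α) (hβ : 0 < β) : Differentiable ℂ (mlE α β) := by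
  intro z
  obtain ⟨T, hT, h⟩ := ml_exists_T hα (r := ‖z‖ + 1) (by positivity)
  have hd : DifferentiableOn ℂ (mlE α β) (Metric.ball 0 (‖z‖ + 1)) := by
    unfold mlE
    refine differentiableOn_tsum_of_summable_norm (u := fun n : ℕ => (T ^ (-β) * Real.exp T) * ((α * n + β) * ((‖z‖ + 1) * T ^ (-α)) ^ n)) ?_ ?_ Metric.isOpen_ball ?_
    · exact (ml_summable_lin (by positivity) h).mul_left _
    · intro n
      fun_prop
    · intro n w hw
      exact ml_term_bound hα hβ hT (by simpa using (mem_ball_zero_iff.1 hw).le) n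
  exact hd.differentiableAt (Metric.isOpen_ball.mem_nhds (by simp))

lemma ml_shift {α β : ℝ} (hα : 0 < α) (hβ : 0 < β) (z : ℂ) :
    mlE α β z = 1 / Complex.Gamma (β : ℂ) + z * mlE α (β + α) z := by
  unfold mlE
  rw [(ml_summable hα hβ z).tsum_eq_zero_add, ← tsum_mul_left]
  congr 1
  · simp
  · congr 1; ext n
    rw [pow_succ']
    have : α * ((n + 1 : ℕ) : ℝ) + β = α * n + (β + α) := by push_cast; ring
    rw [this]; ring

lemma ml_zero {α : ℝ} : mlE α 1 0 = 1 := by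
  unfold mlE
  rw [tsum_eq_single 0]
  · simp
  · intro n hn; simp [hn]

lemma ml_gamma_integrable {a : ℝ} (ha : 0 < a) {r : ℝ} (hr : 0 < r) :
    IntegrableOn (fun t : ℝ => t ^ (a - 1) * Real.exp (-(r * t))) (Ioi 0) := by
  by_contra h
  have h1 := Real.integral_rpow_mul_exp_neg_mul_Ioi ha hr
  rw [integral_undef h] at h1
  have := Real.Gamma_pos_of_pos ha
  have : 0 < (1 / r) ^ a * Real.Gamma a := by positivity
  linarith

lemma ml_cnorm {a : ℝ} {p : ℂ} {t : ℝ} (ht : 0 < t) :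
    ‖((t ^ (a - 1) : ℝ) : ℂ) * Complex.exp (-(p * t))‖ = t ^ (a - 1) * Real.exp (-(p.re * t)) := by
  rw [norm_mul, Complex.norm_exp, Complex.norm_real, Real.norm_eq_abs, abs_of_nonneg (by positivity)]
  simp

lemma ml_cmeas (a : ℝ) (p : ℂ) : AEStronglyMeasurable
    (fun t : ℝ => ((t ^ (a - 1) : ℝ) : ℂ) * Complex.exp (-(p * t))) (volume.restrict (Ioi 0)) := by
  apply Measurable.aestronglyMeasurable
  fun_prop

lemma ml_gamma_cintegrable {a : ℝ} (ha : 0 < a) {p : ℂ} (hp : 0 < p.re) :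
    IntegrableOn (fun t : ℝ => ((t ^ (a - 1) : ℝ) : ℂ) * Complex.exp (-(p * t))) (Ioi 0) := by
  refine (ml_gamma_integrable ha hp).mono' (ml_cmeas a p) ?_
  filter_upwards [ae_restrict_mem measurableSet_Ioi] with t ht
  rw [ml_cnorm ht]

lemma ml_gamma_diff {a : ℝ} (ha : 0 < a) : DifferentiableOn ℂ
    (fun p : ℂ => ∫ t in Ioi (0:ℝ), ((t ^ (a - 1) : ℝ) : ℂ) * Complex.exp (-(p * t))) {p | 0 < p.re} := by
  intro p hp
  apply DifferentiableAt.differentiableWithinAt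
  have hp : 0 < p.re := hp
  have hs : {q : ℂ | p.re / 2 < q.re} ∈ 𝓝 p :=
    (isOpen_lt continuous_const Complex.continuous_re).mem_nhds (by simp; linarith)
  refine (hasDerivAt_integral_of_dominated_loc_of_deriv_le
    (F := fun (q : ℂ) (t : ℝ) => ((t ^ (a - 1) : ℝ) : ℂ) * Complex.exp (-(q * t)))
    (F' := fun (q : ℂ) (t : ℝ) => ((t ^ (a - 1) : ℝ) : ℂ) * (Complex.exp (-(q * t)) * (-t)))
    (bound := fun t => t ^ (a + 1 - 1) * Real.exp (-(p.re / 2 * t))) (μ := volume.restrict (Ioi (0:ℝ))) (x₀ := p)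
    hs ?_ ?_ ?_ ?_ ?_ ?_).2.differentiableAt
  · exact Eventually.of_forall fun q => ml_cmeas a q
  · exact ml_gamma_cintegrable ha hp
  · apply Measurable.aestronglyMeasurable
    fun_prop
  · filter_upwards [ae_restrict_mem measurableSet_Ioi] with t ht q hq
    have ht : 0 < t := ht
    have hq : p.re / 2 < q.re := hq
    rw [← mul_assoc, norm_mul, ml_cnorm ht, norm_neg, Complex.norm_real, Real.norm_eq_abs, abs_of_pos ht]
    have : t ^ (a + 1 - 1) = t ^ (a - 1) * t := by
      rw [← Real.rpow_add_one ht.ne']; congr 1; ring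
    rw [this, mul_assoc, mul_assoc, mul_comm (Real.exp _) t]
    gcongr
  · exact ml_gamma_integrable (by linarith) (by linarith)
  · filter_upwards with t q hq
    have h1 : HasDerivAt (fun q : ℂ => -(q * (t:ℂ))) (-(t:ℂ)) q := by
      simpa using ((hasDerivAt_id q).mul_const (t:ℂ)).fun_neg
    exact (h1.cexp).const_mul _

lemma ml_gamma_int {a : ℝ} (ha : 0 < a) {p : ℂ} (hp : 0 < p.re) :
    ∫ t in Ioi (0:ℝ), ((t ^ (a - 1) : ℝ) : ℂ) * Complex.exp (-(p * t)) =
      p ^ (-(a : ℂ)) * Complex.Gamma a := by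
  have hopen : IsOpen {p : ℂ | 0 < p.re} := isOpen_lt continuous_const Complex.continuous_re
  have h1 := (ml_gamma_diff ha).analyticOnNhd hopen
  have h2 : AnalyticOnNhd ℂ (fun p : ℂ => p ^ (-(a : ℂ)) * Complex.Gamma a) {p | 0 < p.re} := by
    refine DifferentiableOn.analyticOnNhd (fun q hq => ?_) hopen
    have : q ∈ Complex.slitPlane := Or.inl hq
    apply DifferentiableAt.differentiableWithinAt
    exact (DifferentiableAt.cpow_const (by fun_prop) this).mul_const _
  have hpre : IsPreconnected {p : ℂ | 0 < p.re} := (convex_halfSpace_re_gt 0).isPreconnected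
  have heq : ∀ r : ℝ, 0 < r → ∫ t in Ioi (0:ℝ), ((t ^ (a - 1) : ℝ) : ℂ) * Complex.exp (-((r:ℂ) * t)) =
      (r:ℂ) ^ (-(a : ℂ)) * Complex.Gamma a := by
    intro r hr
    have := Real.integral_rpow_mul_exp_neg_mul_Ioi ha hr
    have h3 : ∫ t in Ioi (0:ℝ), ((t ^ (a - 1) : ℝ) : ℂ) * Complex.exp (-((r:ℂ) * t)) =
        ((∫ t in Ioi (0:ℝ), t ^ (a - 1) * Real.exp (-(r * t)) : ℝ) : ℂ) := by
      rw [← integral_complex_ofReal]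
      congr 1; ext t; push_cast; rfl
    rw [h3, this, Complex.Gamma_ofReal, ← Complex.ofReal_neg, ← Complex.ofReal_cpow hr.le, one_div,
      Real.inv_rpow hr.le, Real.rpow_neg hr.le]
    push_cast; rfl
  refine h1.eqOn_of_preconnected_of_frequently_eq h2 hpre (z₀ := 1) (by simp) ?_ hp
  have ht : Tendsto (fun n : ℕ => (((1:ℝ) + 1 / ((n:ℝ) + 1) : ℝ) : ℂ)) atTop (𝓝[≠] 1) := by
    apply tendsto_nhdsWithin_iff.2
    constructor
    · have := (tendsto_one_div_add_atTop_nhds_zero_nat (𝕜 := ℝ)).const_add 1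
      rw [add_zero] at this
      exact (Complex.continuous_ofReal.tendsto _).comp this
    · filter_upwards with n
      have : (0:ℝ) < 1 / ((n:ℝ) + 1) := by positivity
      intro h
      rw [mem_singleton_iff, ← Complex.ofReal_one, Complex.ofReal_inj] at h
      linarith
  refine ht.frequently (Eventually.frequently (Eventually.of_forall fun n => ?_))
  exact heq _ (by positivity)

noncomputable def mlc (α : ℝ) : ℂ := Complex.exp (-Complex.I * Real.pi * α / 2)

noncomputable def mlA (α β : ℝ) : ℂ := (-Complex.I) ^ ((1 - β : ℝ) : ℂ) / α

noncomputable def mlN (α β : ℝ) (p : ℂ) : ℂ :=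
  p ^ ((α - β - 1 : ℝ) : ℂ) * (α * mlc α + β * (p ^ (α : ℂ) - mlc α))

noncomputable def mlL (α β : ℝ) (p : ℂ) : ℂ :=
  mlN α β p / (p ^ (α : ℂ) - mlc α) ^ 2 - mlA α β / (p + Complex.I) ^ 2

noncomputable def mlh (α β : ℝ) (s : ℝ) : ℂ :=
  ((s ^ β : ℝ) : ℂ) * mlE α β (mlc α * ((s ^ α : ℝ) : ℂ))

noncomputable def mlk (α β : ℝ) (s : ℝ) : ℂ :=
  mlh α β s - mlA α β * (s * Complex.exp (-(Complex.I * s)))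

lemma mlc_norm (α : ℝ) : ‖mlc α‖ = 1 := by
  unfold mlc
  have : -Complex.I * Real.pi * α / 2 = ((-(Real.pi * α / 2) : ℝ) : ℂ) * Complex.I := by
    push_cast; ring
  rw [this, Complex.norm_exp_ofReal_mul_I]

lemma mlc_eq (α : ℝ) : mlc α = (-Complex.I) ^ (α : ℂ) := by
  rw [Complex.cpow_def_of_ne_zero (by simp), Complex.log_neg_I]
  unfold mlc; congr 1; ring

lemma mlh_continuousOn {α β : ℝ} (hα : 0 < α) (hβ : 0 < β) : ContinuousOn (mlh α β) (Ioi 0) := by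
  unfold mlh
  have h1 : Continuous (mlE α β) := (ml_differentiable hα hβ).continuous
  have h2 : ∀ b : ℝ, ContinuousOn (fun s : ℝ => ((s ^ b : ℝ) : ℂ)) (Ioi 0) := fun b =>
    Complex.continuous_ofReal.comp_continuousOn
      (ContinuousOn.rpow_const continuousOn_id (fun x hx => Or.inl (ne_of_gt hx)))
  exact (h2 β).mul (h1.comp_continuousOn (continuousOn_const.mul (h2 α)))

lemma mlk_continuousOn {α β : ℝ} (hα : 0 < α) (hβ : 0 < β) : ContinuousOn (mlk α β) (Ioi 0) := by
  unfold mlk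
  refine (mlh_continuousOn hα hβ).sub (Continuous.continuousOn ?_)
  fun_prop

lemma mlh_bound {α β : ℝ} (hα : 0 < α) (hβ : 0 < β) :
    ∃ C : ℝ, ∀ s : ℝ, 0 < s → ‖mlh α β s‖ ≤ C * Real.exp (2 * s) := by
  have hr1 : (2:ℝ) ^ (-α) < 1 := Real.rpow_lt_one_of_one_lt_of_neg (by norm_num) (by linarith)
  have hS := ml_summable_lin (a := α) (b := β) (r := (2:ℝ) ^ (-α)) (by positivity) hr1
  refine ⟨2 ^ (-β) * ∑' n : ℕ, (α * n + β) * ((2:ℝ) ^ (-α)) ^ n, fun s hs => ?_⟩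
  have hr : s ^ α * (2 * s) ^ (-α) = 2 ^ (-α) := by
    rw [Real.mul_rpow (by norm_num) hs.le, Real.rpow_neg hs.le]
    have := (Real.rpow_pos_of_pos hs α).ne'
    field_simp
  have hr' : s ^ β * (2 * s) ^ (-β) = 2 ^ (-β) := by
    rw [Real.mul_rpow (by norm_num) hs.le, Real.rpow_neg hs.le]
    have := (Real.rpow_pos_of_pos hs β).ne'
    field_simp
  have hz : ‖mlc α * ((s ^ α : ℝ) : ℂ)‖ ≤ s ^ α := by
    rw [norm_mul, mlc_norm, one_mul, Complex.norm_real, Real.norm_eq_abs, abs_of_nonneg (by positivity)]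
  have hb := fun n => ml_term_bound (T := 2 * s) hα hβ (by positivity) hz n
  rw [hr] at hb
  have h := tsum_of_norm_bounded (hS.mul_left ((2 * s) ^ (-β) * Real.exp (2 * s))).hasSum hb
  rw [tsum_mul_left] at h
  unfold mlh
  rw [norm_mul, Complex.norm_real, Real.norm_eq_abs, abs_of_nonneg (by positivity)]
  calc s ^ β * ‖mlE α β (mlc α * ((s ^ α : ℝ) : ℂ))‖ ≤ s ^ β * ((2 * s) ^ (-β) * Real.exp (2 * s) * ∑' n : ℕ, (α * n + β) * ((2:ℝ) ^ (-α)) ^ n) := by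
        gcongr; exact h
    _ = (s ^ β * (2 * s) ^ (-β)) * Real.exp (2 * s) * ∑' n : ℕ, (α * n + β) * ((2:ℝ) ^ (-α)) ^ n := by ring
    _ = _ := by rw [hr']; ring

lemma mlh_integrable {α β : ℝ} (hα : 0 < α) (hβ : 0 < β) {p : ℂ} (hp : p.re = 3) :
    IntegrableOn (fun s : ℝ => mlh α β s * Complex.exp (-(p * s))) (Ioi 0) := by
  obtain ⟨C, hC⟩ := mlh_bound hα hβ
  have hi : IntegrableOn (fun s : ℝ => C * Real.exp (-s)) (Ioi 0) := (integrableOn_exp_neg_Ioi 0).const_mul C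
  refine Integrable.mono' hi ?_ ?_
  · refine ContinuousOn.aestronglyMeasurable ?_ measurableSet_Ioi
    exact (mlh_continuousOn hα hβ).mul (Continuous.continuousOn (by fun_prop))
  · filter_upwards [ae_restrict_mem measurableSet_Ioi] with s hs
    rw [norm_mul, Complex.norm_exp]
    have : (-(p * s)).re = -(3 * s) := by simp [hp]
    rw [this]
    calc _ ≤ C * Real.exp (2 * s) * Real.exp (-(3 * s)) := by gcongr; exact hC s hs
      _ = _ := by rw [mul_assoc, ← Real.exp_add]; ring_nf

lemma mlexp_aux (A p : ℂ) (s : ℝ) : A * (s * Complex.exp (-(Complex.I * s))) * Complex.exp (-(p * s)) =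
    A * (((s ^ ((2:ℝ) - 1) : ℝ) : ℂ) * Complex.exp (-((p + Complex.I) * s))) := by
  rw [mul_assoc, mul_assoc, ← Complex.exp_add]
  have : (2:ℝ) - 1 = 1 := by norm_num
  rw [this, Real.rpow_one]; ring_nf

lemma mlk_integrable {α β : ℝ} (hα : 0 < α) (hβ : 0 < β) {p : ℂ} (hp : p.re = 3) :
    IntegrableOn (fun s : ℝ => mlk α β s * Complex.exp (-(p * s))) (Ioi 0) := by
  unfold mlk
  simp only [sub_mul]
  refine (mlh_integrable hα hβ hp).sub ?_
  simp only [mlexp_aux]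
  exact (ml_gamma_cintegrable (a := 2) (by norm_num) (by simp [hp])).const_mul _

lemma mlh_laplace {α β : ℝ} (hα : 0 < α) (hβ : 0 < β) {p : ℂ} (hp : p.re = 3) :
    ∫ s in Ioi (0:ℝ), mlh α β s * Complex.exp (-(p * s)) =
      mlN α β p / (p ^ (α : ℂ) - mlc α) ^ 2 := by
  have hp0 : p ≠ 0 := by rintro rfl; simp at hp
  have hpre : 0 < p.re := by linarith
  have hx : ∀ n : ℕ, 0 < α * n + β := fun n => by positivity
  set F : ℕ → ℝ → ℂ := fun n t => (mlc α ^ n / Complex.Gamma ((α * n + β : ℝ) : ℂ)) *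
    (((t ^ ((α * n + β + 1) - 1) : ℝ) : ℂ) * Complex.exp (-(p * t))) with hF
  have hint : ∀ n, Integrable (F n) (volume.restrict (Ioi 0)) := fun n =>
    (ml_gamma_cintegrable (by linarith [hx n]) hpre).const_mul _
  have hGne : ∀ n : ℕ, Complex.Gamma ((α * n + β : ℝ) : ℂ) ≠ 0 := fun n =>
    Complex.Gamma_ne_zero_of_re_pos (by simpa using hx n)
  have hnorm : ∀ n : ℕ, ∫ t in Ioi (0:ℝ), ‖F n t‖ = (α * n + β) * 3 ^ (-(α * n + (β + 1))) := by
    intro n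
    have h1 : ∫ t in Ioi (0:ℝ), ‖F n t‖ = ∫ t in Ioi (0:ℝ), 1 / Real.Gamma (α * n + β) *
        (t ^ ((α * n + β + 1) - 1) * Real.exp (-(3 * t))) := by
      refine setIntegral_congr_fun measurableSet_Ioi fun t ht => ?_
      simp only [hF]
      rw [norm_mul, ml_cnorm ht, norm_div, norm_pow, mlc_norm, one_pow, ml_norm_Gamma (hx n), hp]
    rw [h1, integral_const_mul, Real.integral_rpow_mul_exp_neg_mul_Ioi (by linarith [hx n]) (by norm_num),
      Real.Gamma_add_one (hx n).ne', one_div (3:ℝ), Real.inv_rpow (by norm_num), ← Real.rpow_neg (by norm_num)]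
    have := (Real.Gamma_pos_of_pos (hx n)).ne'
    field_simp
    congr 2; ring
  have hsum : Summable fun n => ∫ t in Ioi (0:ℝ), ‖F n t‖ := by
    simp only [hnorm]
    have hr1 : (3:ℝ) ^ (-α) < 1 := Real.rpow_lt_one_of_one_lt_of_neg (by norm_num) (by linarith)
    have hS := ml_summable_lin (a := α) (b := β) (r := (3:ℝ) ^ (-α)) (by positivity) hr1
    refine (hS.mul_left (3 ^ (-(β + 1)))).congr fun n => ?_
    rw [ml_rpow_lin (by norm_num)]; ring
  have key := hasSum_integral_of_summable_integral_norm hint hsum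
  have hlhs : ∫ t in Ioi (0:ℝ), ∑' n, F n t = ∫ s in Ioi (0:ℝ), mlh α β s * Complex.exp (-(p * s)) := by
    refine setIntegral_congr_fun measurableSet_Ioi fun t ht => ?_
    have ht : 0 < t := ht
    simp only [hF, mlh, mlE]
    rw [← tsum_mul_left, ← tsum_mul_right]
    congr 1; ext n
    have : t ^ (α * n + β + 1 - 1) = t ^ β * (t ^ α) ^ n := by
      rw [← Real.rpow_natCast, ← Real.rpow_mul ht.le, ← Real.rpow_add ht]; congr 1; ring
    rw [this]; push_cast; ring
  rw [hlhs] at key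
  set w : ℂ := mlc α * p ^ (-(α:ℂ)) with hw
  have hterm : ∀ n, ∫ t in Ioi (0:ℝ), F n t = p ^ (-((β:ℂ) + 1)) * (α * (n * w ^ n) + β * w ^ n) := by
    intro n
    simp only [hF]
    rw [integral_const_mul, ml_gamma_int (by linarith [hx n]) hpre]
    have h1 : Complex.Gamma ((α * n + β + 1 : ℝ) : ℂ) = ((α * n + β : ℝ) : ℂ) * Complex.Gamma ((α * n + β : ℝ) : ℂ) := by
      rw [← Complex.Gamma_add_one _ (by exact_mod_cast (hx n).ne')]; push_cast; rfl
    have h2 : p ^ (-((α * n + β + 1 : ℝ) : ℂ)) = p ^ (-((β:ℂ) + 1)) * (p ^ (-(α:ℂ))) ^ n := by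
      rw [← Complex.cpow_nat_mul, ← Complex.cpow_add _ _ hp0]; congr 1; push_cast; ring
    rw [h1, h2, hw, mul_pow]
    have := hGne n
    field_simp
    push_cast; ring
  simp only [hterm] at key
  have hpn : 3 ≤ ‖p‖ := hp ▸ Complex.re_le_norm p
  have hwn : ‖w‖ < 1 := by
    rw [hw, norm_mul, mlc_norm, one_mul, ← Complex.ofReal_neg, Complex.norm_cpow_real]
    exact Real.rpow_lt_one_of_one_lt_of_neg (by linarith) (by linarith)
  have key2 := (((hasSum_coe_mul_geometric_of_norm_lt_one hwn).mul_left (α:ℂ)).add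
    ((hasSum_geometric_of_norm_lt_one hwn).mul_left (β:ℂ))).mul_left (p ^ (-((β:ℂ) + 1)))
  rw [key.unique key2]
  have hP0 : p ^ (α:ℂ) ≠ 0 := by simp [Complex.cpow_eq_zero_iff, hp0]
  have h3 : p ^ (-((β:ℂ) + 1)) = p ^ ((α - β - 1 : ℝ) : ℂ) / p ^ (α : ℂ) := by
    rw [← Complex.cpow_sub _ _ hp0]; congr 1; push_cast; ring
  have hwne : 1 - w ≠ 0 := by
    intro h; rw [sub_eq_zero] at h; rw [← h] at hwn; simp at hwn
  have h4 : w = mlc α / p ^ (α:ℂ) := by rw [hw, Complex.cpow_neg]; rfl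
  have h5 : 1 - w = (p ^ (α:ℂ) - mlc α) / p ^ (α:ℂ) := by rw [h4]; field_simp
  have hne : p ^ (α:ℂ) - mlc α ≠ 0 := by
    intro h; rw [h5, h, zero_div] at hwne; exact hwne rfl
  rw [h5, h4, h3, mlN]
  field_simp

lemma mlk_laplace {α β : ℝ} (hα : 0 < α) (hβ : 0 < β) {p : ℂ} (hp : p.re = 3) :
    ∫ s in Ioi (0:ℝ), mlk α β s * Complex.exp (-(p * s)) = mlL α β p := by
  have hi := (ml_gamma_cintegrable (a := 2) (p := p + Complex.I) (by norm_num) (by simp [hp])).const_mul (mlA α β)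
  have h2 := ml_gamma_int (a := 2) (p := p + Complex.I) (by norm_num) (by simp [hp])
  unfold mlk mlL
  simp only [sub_mul, mlexp_aux]
  rw [integral_sub (mlh_integrable hα hβ hp) hi, mlh_laplace hα hβ hp, integral_const_mul, h2]
  have h3 : Complex.Gamma ((2:ℝ):ℂ) = 1 := by
    have := Complex.Gamma_nat_eq_factorial 1
    norm_num at this
    simpa using this
  rw [h3, Complex.cpow_neg]
  simp [div_eq_mul_inv]

lemma ml_pow_ne {α : ℝ} (hα1 : 1 < α) (hα2 : α < 2) {p : ℂ} (hre : 0 ≤ p.re) (hp0 : p ≠ 0)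
    (hpI : p ≠ -Complex.I) : p ^ (α : ℂ) - mlc α ≠ 0 := by
  intro h
  rw [sub_eq_zero] at h
  have hn : ‖p‖ = 1 := by
    have h1 := congrArg norm h
    rw [Complex.norm_cpow_real, mlc_norm] at h1
    have := (Real.rpow_left_injOn (x := α) (by linarith : α ≠ 0)) (norm_nonneg p) (by simp : (0:ℝ) ≤ 1)
    exact this (by simpa using h1)
  have hlog : Complex.log p = p.arg * Complex.I := by
    rw [Complex.log, hn]; simp
  rw [Complex.cpow_def_of_ne_zero hp0, hlog, mlc, Complex.exp_eq_exp_iff_exists_int] at h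
  obtain ⟨n, hn'⟩ := h
  have h2 : p.arg * α = -(Real.pi * α / 2) + n * (2 * Real.pi) := by
    have := congrArg Complex.im hn'
    simp at this
    linarith
  have harg := Complex.abs_arg_le_pi_div_two_iff.2 hre
  rw [abs_le] at harg
  have hpi := Real.pi_pos
  have h3 : (n:ℝ) < 1 := by
    have : (n:ℝ) * (2 * Real.pi) < 1 * (2 * Real.pi) := by
      nlinarith
    exact lt_of_mul_lt_mul_right this (by positivity)
  have h4 : (-1:ℝ) < n := by
    have : (-1:ℝ) * (2 * Real.pi) < n * (2 * Real.pi) := by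
      nlinarith
    exact lt_of_mul_lt_mul_right this (by positivity)
  have h5 : n = 0 := by
    have h3' : n < 1 := by exact_mod_cast h3
    have h4' : -1 < n := by exact_mod_cast h4
    omega
  rw [h5] at h2
  have h6 : p.arg = -(Real.pi / 2) := by
    have : α * (p.arg + Real.pi / 2) = 0 := by push_cast at h2; linarith
    rcases mul_eq_zero.1 this with h | h
    · linarith
    · linarith
  apply hpI
  rw [← Complex.norm_mul_exp_arg_mul_I p, hn, h6]
  have : ((-(Real.pi / 2) : ℝ) : ℂ) * Complex.I = -(Real.pi / 2 * Complex.I) := by push_cast; ring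
  rw [this, Complex.exp_neg, Complex.exp_pi_div_two_mul_I]
  simp

lemma ml_negI_slit : -Complex.I ∈ Complex.slitPlane := by
  right; simp

lemma mlL_near {α β : ℝ} (hα1 : 1 < α) :
    ∃ ε > 0, ∃ C : ℝ, ∀ p ∈ Metric.ball (-Complex.I) ε, p ≠ -Complex.I → ‖mlL α β p‖ ≤ C := by
  have hα0 : (α:ℂ) ≠ 0 := by exact_mod_cast (by linarith : α ≠ 0)
  have hcp : ∀ b : ℂ, DifferentiableOn ℂ (fun p : ℂ => p ^ b) Complex.slitPlane := fun b p hp =>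
    (DifferentiableAt.cpow_const (by fun_prop) hp).differentiableWithinAt
  have hslit : Complex.slitPlane ∈ 𝓝 (-Complex.I) := Complex.isOpen_slitPlane.mem_nhds ml_negI_slit
  set q := dslope (fun p : ℂ => p ^ (α:ℂ)) (-Complex.I) with hq
  have hqd : DifferentiableOn ℂ q Complex.slitPlane := (Complex.differentiableOn_dslope hslit).2 (hcp _)
  have hqI : q (-Complex.I) = α * (-Complex.I) ^ ((α:ℂ) - 1) := by
    rw [hq, dslope_same]
    have := (hasDerivAt_id (-Complex.I)).cpow_const (c := (α:ℂ)) ml_negI_slit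
    simpa using this.deriv
  have hqI0 : q (-Complex.I) ≠ 0 := by
    rw [hqI]; refine mul_ne_zero hα0 ?_; simp [Complex.cpow_eq_zero_iff]
  have hqc : ContinuousAt q (-Complex.I) := (hqd.differentiableAt hslit).continuousAt
  obtain ⟨r, hr, hball⟩ := Metric.mem_nhds_iff.1 (Filter.inter_mem hslit (hqc.eventually_ne hqI0))
  set U := Metric.ball (-Complex.I) r with hU
  have hUo : IsOpen U := Metric.isOpen_ball
  have hUs : ∀ p ∈ U, p ∈ Complex.slitPlane := fun p hp => (hball hp).1
  have hUq : ∀ p ∈ U, q p ≠ 0 := fun p hp => (hball hp).2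
  have hUn : U ∈ 𝓝 (-Complex.I) := Metric.ball_mem_nhds _ hr
  set G : ℂ → ℂ := fun p => p ^ ((α:ℂ) - β) / q p with hG
  have hGd : DifferentiableOn ℂ G U := ((hcp _).mono hUs).div (hqd.mono hUs) hUq
  set H := dslope G (-Complex.I) with hH
  have hHd : DifferentiableOn ℂ H U := (Complex.differentiableOn_dslope hUn).2 hGd
  have hHc : ContinuousAt (deriv H) (-Complex.I) :=
    (((hHd.deriv hUo).differentiableAt hUn)).continuousAt
  have hGI : G (-Complex.I) = mlA α β := by
    simp only [hG, mlA, hqI]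
    have h1 : (-Complex.I) ^ ((α:ℂ) - β) = (-Complex.I) ^ ((1 - β : ℝ) : ℂ) * (-Complex.I) ^ ((α:ℂ) - 1) := by
      rw [← Complex.cpow_add _ _ (by simp)]; congr 1; push_cast; ring
    have h2 : (-Complex.I) ^ ((α:ℂ) - 1) ≠ 0 := by simp [Complex.cpow_eq_zero_iff]
    rw [h1]; field_simp
  have hqv : ∀ p, p ≠ -Complex.I → q p = (p ^ (α:ℂ) - mlc α) / (p + Complex.I) := by
    intro p hp
    rw [hq, dslope_of_ne _ hp, slope_def_field, mlc_eq]; congr 1; ring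
  have hHv : ∀ p, p ≠ -Complex.I → H p = p ^ ((α:ℂ) - β) / (p ^ (α:ℂ) - mlc α) - mlA α β / (p + Complex.I) := by
    intro p hp
    have hpI : p + Complex.I ≠ 0 := fun h => hp (eq_neg_of_add_eq_zero_left h)
    rw [hH, dslope_of_ne _ hp, slope_def_field, hGI, hG]
    simp only
    rw [hqv p hp, sub_neg_eq_add, sub_div]
    congr 1
    rw [div_div_eq_mul_div, mul_div_assoc, mul_comm, mul_div_assoc, div_mul_div_comm]
    field_simp
  have hLd : ∀ p ∈ U, p ≠ -Complex.I → mlL α β p = - deriv H p := by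
    intro p hpU hp
    have hpI : p + Complex.I ≠ 0 := fun h => hp (eq_neg_of_add_eq_zero_left h)
    have hne : p ^ (α:ℂ) - mlc α ≠ 0 := by
      intro h; apply hUq p hpU; rw [hqv p hp, h, zero_div]
    have hs := hUs p hpU
    have hp0 : p ≠ 0 := Complex.slitPlane_ne_zero hs
    have hev : H =ᶠ[𝓝 p] fun p => p ^ ((α:ℂ) - β) / (p ^ (α:ℂ) - mlc α) - mlA α β / (p + Complex.I) := by
      filter_upwards [isOpen_ne.mem_nhds hp] with x hx using hHv x hx
    rw [hev.deriv_eq]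
    have h1 : HasDerivAt (fun p : ℂ => p ^ ((α:ℂ) - β)) (((α:ℂ) - β) * p ^ ((α:ℂ) - β - 1)) p := by
      simpa using (hasDerivAt_id p).cpow_const (c := (α:ℂ) - β) hs
    have h2 : HasDerivAt (fun p : ℂ => p ^ (α:ℂ)) ((α:ℂ) * p ^ ((α:ℂ) - 1)) p := by
      simpa using (hasDerivAt_id p).cpow_const (c := (α:ℂ)) hs
    have h3 : HasDerivAt (fun p : ℂ => p + Complex.I) 1 p := (hasDerivAt_id p).add_const _
    have h4 := (h1.fun_div (h2.sub_const (mlc α)) hne).fun_sub ((hasDerivAt_const p (mlA α β)).fun_div h3 hpI)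
    rw [h4.deriv]
    have e1 : p ^ ((α:ℂ) - β) * p ^ ((α:ℂ) - 1) = p ^ ((α - β - 1 : ℝ):ℂ) * p ^ (α:ℂ) := by
      rw [← Complex.cpow_add _ _ hp0, ← Complex.cpow_add _ _ hp0]; congr 1; push_cast; ring
    have e2 : p ^ ((α:ℂ) - β - 1) = p ^ ((α - β - 1 : ℝ):ℂ) := by congr 1; push_cast; ring
    have e3 : p ^ ((α:ℂ) - β) * (α * p ^ ((α:ℂ) - 1)) = α * (p ^ ((α - β - 1 : ℝ):ℂ) * p ^ (α:ℂ)) := by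
      rw [← e1]; ring
    rw [e2, e3, mlL, mlN]
    field_simp
    ring
  have hbd : ∀ᶠ p in 𝓝 (-Complex.I), ‖deriv H p‖ < ‖deriv H (-Complex.I)‖ + 1 :=
    hHc.norm.eventually (gt_mem_nhds (by linarith))
  obtain ⟨ε, hε, hb⟩ := Metric.mem_nhds_iff.1 (Filter.inter_mem hUn hbd)
  refine ⟨ε, hε, ‖deriv H (-Complex.I)‖ + 1, fun p hp hpI => ?_⟩
  rw [hLd p (hb hp).1 hpI, norm_neg]
  exact le_of_lt (hb hp).2

lemma mlN_norm_le {α β : ℝ} (hα : 0 < α) (hβ : 0 < β) (p : ℂ) :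
    ‖mlN α β p‖ ≤ ‖p‖ ^ (α - β - 1) * (α + β * (‖p‖ ^ α + 1)) := by
  unfold mlN
  rw [norm_mul, Complex.norm_cpow_real]
  gcongr
  refine (norm_add_le _ _).trans ?_
  rw [norm_mul, norm_mul, mlc_norm, Complex.norm_real, Complex.norm_real, Real.norm_eq_abs, Real.norm_eq_abs,
    abs_of_pos hα, abs_of_pos hβ, mul_one]
  gcongr
  refine (norm_sub_le _ _).trans ?_
  rw [Complex.norm_cpow_real, mlc_norm]

lemma mlN_small {α β : ℝ} (hα1 : 1 < α) (hβ0 : 0 < β) (hβ : β ≤ 1 ∨ β = α)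
    {p : ℂ} (hp0 : p ≠ 0) (hp : ‖p‖ ≤ 1) : ‖mlN α β p‖ ≤ (α + 2 * β) * ‖p‖ ^ (α - 2) := by
  have hn : 0 < ‖p‖ := norm_pos_iff.2 hp0
  rcases hβ with hβ | rfl
  · refine (mlN_norm_le (by linarith) hβ0 p).trans ?_
    have h1 : ‖p‖ ^ α ≤ 1 := Real.rpow_le_one hn.le hp (by linarith)
    have h2 : ‖p‖ ^ (α - β - 1) ≤ ‖p‖ ^ (α - 2) := Real.rpow_le_rpow_of_exponent_ge hn hp (by linarith)
    rw [mul_comm]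
    have h3 : α + β * (‖p‖ ^ α + 1) ≤ α + 2 * β := by nlinarith
    exact mul_le_mul h3 h2 (by positivity) (by positivity)
  · unfold mlN
    rw [← mul_add, add_sub_cancel, norm_mul, norm_mul, Complex.norm_cpow_real, Complex.norm_cpow_real,
      Complex.norm_real, Real.norm_eq_abs, abs_of_pos hβ0]
    have h3 : ‖p‖ ^ (β - β - 1) * (β * ‖p‖ ^ β) = β * ‖p‖ ^ (β - 1) := by
      rw [mul_left_comm, ← Real.rpow_add hn]; congr 2; ring
    have h2 : ‖p‖ ^ (β - 1) ≤ ‖p‖ ^ (β - 2) := Real.rpow_le_rpow_of_exponent_ge hn hp (by linarith)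
    rw [h3]
    gcongr
    linarith

lemma mlN_large {α β : ℝ} (hα1 : 1 < α) (hβ0 : 0 < β) (hβ : 2 - α ≤ β)
    {p : ℂ} (hp : 1 ≤ ‖p‖) : ‖mlN α β p‖ ≤ (α + 2 * β) * ‖p‖ ^ (3 * α - 3) := by
  have hn : 0 < ‖p‖ := by linarith
  refine (mlN_norm_le (by linarith) hβ0 p).trans ?_
  have h1 : 1 ≤ ‖p‖ ^ α := Real.one_le_rpow hp (by linarith)
  have h2 : ‖p‖ ^ (α - β - 1) ≤ ‖p‖ ^ (2 * α - 3) := Real.rpow_le_rpow_of_exponent_le hp (by linarith)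
  have h3 : ‖p‖ ^ (3 * α - 3) = ‖p‖ ^ (2 * α - 3) * ‖p‖ ^ α := by
    rw [← Real.rpow_add hn]; congr 1; ring
  rw [h3]
  calc _ ≤ ‖p‖ ^ (2 * α - 3) * ((α + 2 * β) * ‖p‖ ^ α) := by
        gcongr
        nlinarith
    _ = _ := by ring

lemma mlL_small {α β : ℝ} (hα1 : 1 < α) (hα2 : α < 2) (hβ0 : 0 < β) (hβ : β ≤ 1 ∨ β = α) :
    ∃ C : ℝ, 0 ≤ C ∧ ∀ p : ℂ, p ≠ 0 → ‖p‖ ≤ 1 / 2 → ‖mlL α β p‖ ≤ C * ‖p‖ ^ (α - 2) := by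
  refine ⟨4 * (α + 2 * β) + 4 * ‖mlA α β‖, by positivity, fun p hp0 hp => ?_⟩
  have hn : 0 < ‖p‖ := norm_pos_iff.2 hp0
  have h1 : ‖p‖ ^ α ≤ 1 / 2 := by
    calc ‖p‖ ^ α ≤ ‖p‖ ^ (1:ℝ) := Real.rpow_le_rpow_of_exponent_ge hn (by linarith) hα1.le
      _ ≤ _ := by rw [Real.rpow_one]; exact hp
  have h2 : 1 / 2 ≤ ‖p ^ (α:ℂ) - mlc α‖ := by
    have := norm_sub_norm_le (mlc α) (p ^ (α:ℂ))
    rw [mlc_norm, Complex.norm_cpow_real, norm_sub_rev] at this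
    linarith
  have h3 : 1 / 2 ≤ ‖p + Complex.I‖ := by
    have := norm_sub_norm_le Complex.I (-p)
    rw [norm_neg, Complex.norm_I, sub_neg_eq_add, add_comm] at this
    linarith
  have h4 : 1 ≤ ‖p‖ ^ (α - 2) := Real.one_le_rpow_of_pos_of_le_one_of_nonpos hn (by linarith) (by linarith)
  have h5 := mlN_small hα1 hβ0 hβ hp0 (by linarith)
  unfold mlL
  refine (norm_sub_le _ _).trans ?_
  rw [norm_div, norm_div, norm_pow, norm_pow, add_mul]
  have h6 : 1 / 4 ≤ ‖p ^ (α:ℂ) - mlc α‖ ^ 2 := by nlinarith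
  have h7 : 1 / 4 ≤ ‖p + Complex.I‖ ^ 2 := by nlinarith
  refine add_le_add ?_ ?_
  · rw [div_le_iff₀ (by linarith)]
    have : 0 ≤ (α + 2 * β) * ‖p‖ ^ (α - 2) := by positivity
    nlinarith
  · rw [div_le_iff₀ (by linarith)]
    have : 0 ≤ ‖mlA α β‖ := norm_nonneg _
    calc ‖mlA α β‖ = 4 * ‖mlA α β‖ * 1 * (1 / 4) := by ring
      _ ≤ _ := by gcongr

lemma mlL_large {α β : ℝ} (hα1 : 1 < α) (hα2 : α < 2) (hβ0 : 0 < β) (hβ : 2 - α ≤ β) :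
    ∃ C : ℝ, 0 ≤ C ∧ ∀ p : ℂ, 2 ≤ ‖p‖ → ‖mlL α β p‖ ≤ C * ‖p‖ ^ (-(3 - α)) := by
  refine ⟨4 * (α + 2 * β) + 4 * ‖mlA α β‖, by positivity, fun p hp => ?_⟩
  have hn : 0 < ‖p‖ := by linarith
  have h1 : 2 ≤ ‖p‖ ^ α := by
    calc 2 ≤ ‖p‖ ^ (1:ℝ) := by rw [Real.rpow_one]; exact hp
      _ ≤ _ := Real.rpow_le_rpow_of_exponent_le (by linarith) hα1.le
  have h2 : ‖p‖ ^ α / 2 ≤ ‖p ^ (α:ℂ) - mlc α‖ := by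
    have := norm_sub_norm_le (p ^ (α:ℂ)) (mlc α)
    rw [mlc_norm, Complex.norm_cpow_real] at this
    linarith
  have h3 : ‖p‖ / 2 ≤ ‖p + Complex.I‖ := by
    have := norm_sub_norm_le p (-Complex.I)
    rw [norm_neg, Complex.norm_I, sub_neg_eq_add] at this
    linarith
  have h5 := mlN_large hα1 hβ0 hβ (p := p) (by linarith)
  unfold mlL
  refine (norm_sub_le _ _).trans ?_
  rw [norm_div, norm_div, norm_pow, norm_pow, add_mul]
  have h6 : (‖p‖ ^ α / 2) ^ 2 ≤ ‖p ^ (α:ℂ) - mlc α‖ ^ 2 := by gcongr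
  have h7 : (‖p‖ / 2) ^ 2 ≤ ‖p + Complex.I‖ ^ 2 := by gcongr
  refine add_le_add ?_ ?_
  · rw [div_le_iff₀ (lt_of_lt_of_le (by positivity) h6)]
    refine h5.trans ?_
    have e : ‖p‖ ^ (3 * α - 3) = ‖p‖ ^ (-(3 - α)) * (‖p‖ ^ α) ^ 2 := by
      rw [← Real.rpow_natCast, ← Real.rpow_mul hn.le, ← Real.rpow_add hn]; congr 1; push_cast; ring
    calc (α + 2 * β) * ‖p‖ ^ (3 * α - 3) = 4 * (α + 2 * β) * ‖p‖ ^ (-(3 - α)) * (‖p‖ ^ α / 2) ^ 2 := by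
          rw [e]; ring
      _ ≤ _ := by gcongr
  · rw [div_le_iff₀ (lt_of_lt_of_le (by positivity) h7)]
    have e : 1 ≤ ‖p‖ ^ (-(3 - α)) * ‖p‖ ^ 2 := by
      rw [← Real.rpow_natCast, ← Real.rpow_add hn]
      exact Real.one_le_rpow (by linarith) (by push_cast; linarith)
    calc ‖mlA α β‖ ≤ ‖mlA α β‖ * (‖p‖ ^ (-(3 - α)) * ‖p‖ ^ 2) := le_mul_of_one_le_right (norm_nonneg _) e
      _ = 4 * ‖mlA α β‖ * ‖p‖ ^ (-(3 - α)) * (‖p‖ / 2) ^ 2 := by ring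
      _ ≤ _ := by gcongr

lemma mlL_diffAt {α β : ℝ} {p : ℂ} (hs : p ∈ Complex.slitPlane)
    (h1 : p ^ (α : ℂ) - mlc α ≠ 0) (h2 : p + Complex.I ≠ 0) : DifferentiableAt ℂ (mlL α β) p := by
  have hcp : ∀ b : ℂ, DifferentiableAt ℂ (fun p : ℂ => p ^ b) p := fun b =>
    (DifferentiableAt.cpow_const (by fun_prop) hs)
  unfold mlL mlN
  have := hcp ((α - β - 1 : ℝ) : ℂ)
  have := hcp α
  refine DifferentiableAt.sub (DifferentiableAt.div ?_ ?_ (pow_ne_zero _ h1)) (DifferentiableAt.div ?_ ?_ (pow_ne_zero _ h2)) <;> fun_prop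

lemma mlL_mid {α β : ℝ} (hα1 : 1 < α) (hα2 : α < 2) :
    ∃ C : ℝ, 0 ≤ C ∧ ∀ p : ℂ, 0 ≤ p.re → p ≠ -Complex.I → 1 / 2 ≤ ‖p‖ → ‖p‖ ≤ 5 → ‖mlL α β p‖ ≤ C := by
  obtain ⟨ε, hε, C1, hC1⟩ := mlL_near (β := β) hα1
  set K : Set ℂ := (Metric.closedBall 0 5) ∩ ({p | 0 ≤ p.re} ∩ ({p | 1 / 2 ≤ ‖p‖} ∩ (Metric.ball (-Complex.I) ε)ᶜ)) with hK
  have hKc : IsCompact K := by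
    refine (isCompact_closedBall 0 5).inter_right ?_
    exact (isClosed_le continuous_const Complex.continuous_re).inter
      ((isClosed_le continuous_const continuous_norm).inter Metric.isOpen_ball.isClosed_compl)
  have hKcont : ContinuousOn (mlL α β) K := by
    rintro p ⟨-, h1, h2, h3⟩
    have h1 : 0 ≤ p.re := h1
    have h2 : 1 / 2 ≤ ‖p‖ := h2
    have hp0 : p ≠ 0 := by rintro rfl; norm_num at h2
    have hpI : p ≠ -Complex.I := by rintro rfl; exact h3 (Metric.mem_ball_self hε)
    refine (mlL_diffAt ?_ (ml_pow_ne hα1 hα2 h1 hp0 hpI) (fun h => hpI (eq_neg_of_add_eq_zero_left h))).continuousAt.continuousWithinAt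
    rcases h1.lt_or_eq with h | h
    · exact Or.inl h
    · right; intro h'; exact hp0 (Complex.ext h.symm h')
  obtain ⟨C2, hC2⟩ := hKc.exists_bound_of_continuousOn hKcont
  refine ⟨max 0 (max C1 C2), le_max_left _ _, fun p h1 h2 h3 h4 => ?_⟩
  by_cases h : p ∈ Metric.ball (-Complex.I) ε
  · exact (hC1 p h h2).trans (by simp)
  · exact (hC2 p ⟨by simpa using h4, h1, h3, h⟩).trans (by simp)

noncomputable def mlM (α : ℝ) (y : ℝ) : ℝ :=
  (1 + ‖y‖) ^ (-(3 - α)) + (Icc (-1:ℝ) 1).indicator (fun y => |y| ^ (α - 2)) y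

lemma mlL_bound {α β : ℝ} (hα1 : 1 < α) (hα2 : α < 2) (hβ0 : 0 < β) (hβ : 2 - α ≤ β) (hβ' : β ≤ 1 ∨ β = α) :
    ∃ C : ℝ, 0 ≤ C ∧ ∀ p : ℂ, 0 < p.re → p.re ≤ 3 → p.im ≠ 0 → ‖mlL α β p‖ ≤ C * mlM α p.im := by
  obtain ⟨C1, hC1, h1⟩ := mlL_small hα1 hα2 hβ0 hβ'
  obtain ⟨C2, hC2, h2⟩ := mlL_large hα1 hα2 hβ0 hβ
  obtain ⟨C3, hC3, h3⟩ := mlL_mid (β := β) hα1 hα2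
  refine ⟨C1 + C2 * 2 ^ (3 - α) + C3 * 3 ^ (3 - α), by positivity, fun p hp hp3 hy => ?_⟩
  have hy0 : 0 < |p.im| := abs_pos.2 hy
  have hyn := Complex.abs_im_le_norm p
  have hp0 : p ≠ 0 := by rintro rfl; simp at hp
  have hpI : p ≠ -Complex.I := by rintro rfl; simp at hp
  have hi : 0 ≤ (Icc (-1:ℝ) 1).indicator (fun y => |y| ^ (α - 2)) p.im :=
    indicator_nonneg (fun y _ => by positivity) _
  have hj : 0 ≤ (1 + ‖p.im‖) ^ (-(3 - α)) := by positivity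
  by_cases hs : ‖p‖ ≤ 1 / 2
  · have hm : p.im ∈ Icc (-1:ℝ) 1 := by
      rw [mem_Icc, ← abs_le]; linarith
    have : |p.im| ^ (α - 2) ≤ mlM α p.im := by
      unfold mlM
      rw [indicator_of_mem hm]
      linarith
    calc _ ≤ C1 * ‖p‖ ^ (α - 2) := h1 p hp0 hs
      _ ≤ C1 * |p.im| ^ (α - 2) := by
        gcongr 1
        exact Real.rpow_le_rpow_of_nonpos hy0 hyn (by linarith)
      _ ≤ (C1 + C2 * 2 ^ (3 - α) + C3 * 3 ^ (3 - α)) * mlM α p.im := by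
        gcongr
        have : 0 ≤ C2 * 2 ^ (3 - α) + C3 * 3 ^ (3 - α) := by positivity
        linarith
  · have hs : 1 / 2 ≤ ‖p‖ := le_of_not_ge hs
    have hM : (1 + ‖p.im‖) ^ (-(3 - α)) ≤ mlM α p.im := by unfold mlM; linarith
    by_cases hl : 2 ≤ |p.im|
    · have e : |p.im| ^ (-(3 - α)) ≤ 2 ^ (3 - α) * (1 + ‖p.im‖) ^ (-(3 - α)) := by
        have : (2:ℝ) ^ (3 - α) = (1 / 2) ^ (-(3 - α)) := by
          rw [one_div, Real.inv_rpow (by norm_num), Real.rpow_neg (by norm_num), inv_inv]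
        rw [this, ← Real.mul_rpow (by norm_num) (by positivity), Real.norm_eq_abs]
        exact Real.rpow_le_rpow_of_nonpos (by linarith) (by linarith) (by linarith)
      calc _ ≤ C2 * ‖p‖ ^ (-(3 - α)) := h2 p (by linarith)
        _ ≤ C2 * |p.im| ^ (-(3 - α)) := by
          gcongr 1
          exact Real.rpow_le_rpow_of_nonpos hy0 hyn (by linarith)
        _ ≤ C2 * (2 ^ (3 - α) * (1 + ‖p.im‖) ^ (-(3 - α))) := by gcongr
        _ ≤ C2 * (2 ^ (3 - α) * mlM α p.im) := by gcongr
        _ ≤ _ := by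
          have : 0 ≤ mlM α p.im := hj.trans hM
          have : 0 ≤ (C1 + C3 * 3 ^ (3 - α)) * mlM α p.im := by positivity
          linarith
    · have hl : |p.im| ≤ 2 := le_of_not_ge hl
      have hn5 : ‖p‖ ≤ 5 := by
        have := Complex.norm_le_abs_re_add_abs_im p
        rw [abs_of_pos hp] at this
        linarith
      have e : 1 ≤ 3 ^ (3 - α) * (1 + ‖p.im‖) ^ (-(3 - α)) := by
        have : (3:ℝ) ^ (3 - α) = (1 / 3) ^ (-(3 - α)) := by
          rw [one_div, Real.inv_rpow (by norm_num), Real.rpow_neg (by norm_num), inv_inv]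
        rw [this, ← Real.mul_rpow (by norm_num) (by positivity), Real.norm_eq_abs]
        exact Real.one_le_rpow_of_pos_of_le_one_of_nonpos (by positivity) (by linarith) (by linarith)
      calc _ ≤ C3 * 1 := by rw [mul_one]; exact h3 p hp.le hpI hs hn5
        _ ≤ C3 * (3 ^ (3 - α) * (1 + ‖p.im‖) ^ (-(3 - α))) := by gcongr
        _ ≤ C3 * (3 ^ (3 - α) * mlM α p.im) := by gcongr
        _ ≤ _ := by
          have : 0 ≤ mlM α p.im := hj.trans hM
          have : 0 ≤ (C1 + C2 * 2 ^ (3 - α)) * mlM α p.im := by positivity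
          linarith

lemma mlM_nonneg (α y : ℝ) : 0 ≤ mlM α y := by
  unfold mlM
  have hi : 0 ≤ (Icc (-1:ℝ) 1).indicator (fun y => |y| ^ (α - 2)) y :=
    indicator_nonneg (fun y _ => by positivity) _
  positivity

lemma mlM_integrable {α : ℝ} (hα1 : 1 < α) (hα2 : α < 2) : Integrable (mlM α) := by
  unfold mlM
  refine Integrable.add (integrable_one_add_norm (by simp; linarith)) ?_
  rw [integrable_indicator_iff measurableSet_Icc]
  have h1 : IntervalIntegrable (fun x : ℝ => x ^ (α - 2)) volume 0 1 :=
    intervalIntegral.intervalIntegrable_rpow' (by linarith)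
  have h2 : IntervalIntegrable (fun x : ℝ => |x| ^ (α - 2)) volume 0 1 := by
    refine h1.congr ?_
    intro x hx
    rw [uIoc_of_le zero_le_one] at hx
    simp only
    rw [abs_of_pos hx.1]
  have h3 : IntervalIntegrable (fun x : ℝ => |x| ^ (α - 2)) volume (-1) 0 := by
    have := (IntervalIntegrable.iff_comp_neg (by simp)).1 h2
    simpa using this.symm
  have h4 := h3.trans h2
  rwa [intervalIntegrable_iff_integrableOn_Icc_of_le (by norm_num)] at h4

lemma mlM_tendsto {α : ℝ} (hα2 : α < 2) : Tendsto (mlM α) atTop (𝓝 0) := by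
  have h1 : Tendsto (fun y : ℝ => (1 + y) ^ (-(3 - α))) atTop (𝓝 0) :=
    (tendsto_rpow_neg_atTop (by linarith)).comp (tendsto_atTop_add_const_left _ _ tendsto_id)
  refine h1.congr' ?_
  filter_upwards [eventually_gt_atTop 1] with y hy
  unfold mlM
  rw [indicator_of_notMem (by intro h; linarith [h.2]), Real.norm_eq_abs, abs_of_pos (by linarith), add_zero]

lemma mlM_neg (α y : ℝ) : mlM α (-y) = mlM α y := by
  unfold mlM
  have : (-y ∈ Icc (-1:ℝ) 1) ↔ (y ∈ Icc (-1:ℝ) 1) := by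
    rw [mem_Icc, mem_Icc, ← abs_le, ← abs_le, abs_neg]
  rw [norm_neg]
  by_cases h : y ∈ Icc (-1:ℝ) 1
  · rw [indicator_of_mem h, indicator_of_mem (this.2 h), abs_neg]
  · rw [indicator_of_notMem h, indicator_of_notMem (fun h' => h (this.1 h'))]

lemma mlL_diffOn {α β : ℝ} (hα1 : 1 < α) (hα2 : α < 2) {p : ℂ} (hp : 0 < p.re) :
    DifferentiableAt ℂ (mlL α β) p := by
  have hpI : p ≠ -Complex.I := by rintro rfl; simp at hp
  have hp0 : p ≠ 0 := by rintro rfl; simp at hp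
  exact mlL_diffAt (Or.inl hp) (ml_pow_ne hα1 hα2 hp.le hp0 hpI) (fun h => hpI (eq_neg_of_add_eq_zero_left h))

lemma ml_line_cont {α β : ℝ} (hα1 : 1 < α) (hα2 : α < 2) {σ : ℝ} (hσ : 0 < σ) :
    Continuous fun y : ℝ => mlL α β (σ + y * Complex.I) := by
  rw [continuous_iff_continuousAt]
  intro y
  have h1 : ContinuousAt (mlL α β) (σ + y * Complex.I) :=
    (mlL_diffOn hα1 hα2 (by simpa using hσ)).continuousAt
  exact ContinuousAt.comp (f := fun y : ℝ => (σ:ℂ) + y * Complex.I) h1 (by fun_prop)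

lemma ml_line_bound {α β C : ℝ}
    (hC : ∀ p : ℂ, 0 < p.re → p.re ≤ 3 → p.im ≠ 0 → ‖mlL α β p‖ ≤ C * mlM α p.im)
    {s σ : ℝ} (hσ : 0 < σ) (hσ3 : σ ≤ 3) {y : ℝ} (hy : y ≠ 0) :
    ‖Complex.exp ((σ + y * Complex.I) * s) * mlL α β (σ + y * Complex.I)‖ ≤
      Real.exp (σ * s) * (C * mlM α y) := by
  rw [norm_mul, Complex.norm_exp]
  have h := hC (σ + y * Complex.I) (by simpa using hσ) (by simpa using hσ3) (by simpa using hy)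
  have e : ((σ + y * Complex.I) * s).re = σ * s := by simp
  have e2 : ((σ:ℂ) + y * Complex.I).im = y := by simp
  rw [e2] at h
  rw [e]
  gcongr

lemma ml_ae_ne : ∀ᵐ y : ℝ, y ≠ 0 := by
  simp [ae_iff]

lemma ml_line_integrable {α β C : ℝ} (hα1 : 1 < α) (hα2 : α < 2)
    (hC : ∀ p : ℂ, 0 < p.re → p.re ≤ 3 → p.im ≠ 0 → ‖mlL α β p‖ ≤ C * mlM α p.im)
    (s : ℝ) {σ : ℝ} (hσ : 0 < σ) (hσ3 : σ ≤ 3) :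
    Integrable fun y : ℝ => Complex.exp ((σ + y * Complex.I) * s) * mlL α β (σ + y * Complex.I) := by
  refine Integrable.mono' (((mlM_integrable hα1 hα2).const_mul C).const_mul (Real.exp (σ * s))) ?_ ?_
  · have := ml_line_cont (β := β) hα1 hα2 hσ
    exact Continuous.aestronglyMeasurable (by fun_prop)
  · filter_upwards [ml_ae_ne] with y hy
    exact ml_line_bound hC hσ hσ3 hy

lemma ml_contour {α β C : ℝ} (hα1 : 1 < α) (hα2 : α < 2) (hC0 : 0 ≤ C)
    (hC : ∀ p : ℂ, 0 < p.re → p.re ≤ 3 → p.im ≠ 0 → ‖mlL α β p‖ ≤ C * mlM α p.im)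
    {s σ Y : ℝ} (hs : 0 < s) (hσ : 0 < σ) (hσ3 : σ ≤ 3) (hY : 0 < Y) :
    ‖∫ y in (-Y)..Y, Complex.exp ((((3:ℝ):ℂ) + y * Complex.I) * s) * mlL α β (((3:ℝ):ℂ) + y * Complex.I)‖ ≤
      Real.exp (σ * s) * (C * ∫ y, mlM α y) + 6 * (Real.exp (3 * s) * (C * mlM α Y)) := by
  set f : ℂ → ℂ := fun p => Complex.exp (p * s) * mlL α β p with hf
  have hrect := Complex.integral_boundary_rect_eq_zero_of_differentiableOn f ⟨σ, -Y⟩ ⟨3, Y⟩ (by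
    intro p hp
    have h1 : p.re ∈ uIcc σ 3 := hp.1
    rw [uIcc_of_le hσ3] at h1
    have := mlL_diffOn (β := β) hα1 hα2 (lt_of_lt_of_le hσ h1.1)
    exact DifferentiableAt.differentiableWithinAt (by fun_prop))
  simp only at hrect
  have hh : ∀ y : ℝ, y ≠ 0 → ‖∫ x in σ..3, f (x + y * Complex.I)‖ ≤ 3 * (Real.exp (3 * s) * (C * mlM α y)) := by
    intro y hy
    have hM := mlM_nonneg α y
    have := intervalIntegral.norm_integral_le_of_norm_le_const (a := σ) (b := 3)
      (f := fun x : ℝ => f (x + y * Complex.I)) (C := Real.exp (3 * s) * (C * mlM α y)) (by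
        intro x hx
        rw [uIoc_of_le hσ3] at hx
        refine (ml_line_bound hC (hσ.trans hx.1) hx.2 hy).trans ?_
        gcongr
        exact hx.2)
    refine this.trans ?_
    rw [abs_of_nonneg (by linarith), mul_comm]
    gcongr
    linarith
  have hv : ‖∫ y in (-Y)..Y, f (σ + y * Complex.I)‖ ≤ Real.exp (σ * s) * (C * ∫ y, mlM α y) := by
    have hint : Integrable (fun y => Real.exp (σ * s) * (C * mlM α y)) :=
      ((mlM_integrable hα1 hα2).const_mul C).const_mul (Real.exp (σ * s))
    have h1 : ‖∫ y in (-Y)..Y, f (σ + y * Complex.I)‖ ≤ ∫ y in (-Y)..Y, Real.exp (σ * s) * (C * mlM α y) := by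
      refine intervalIntegral.norm_integral_le_of_norm_le (by linarith) ?_ hint.intervalIntegrable
      filter_upwards [ml_ae_ne] with y hy _
      exact ml_line_bound hC hσ hσ3 hy
    refine h1.trans ?_
    rw [← integral_const_mul, ← integral_const_mul, intervalIntegral.integral_of_le (by linarith)]
    refine setIntegral_le_integral hint ?_
    filter_upwards with y
    have hM := mlM_nonneg α y
    simp only [Pi.zero_apply]
    positivity
  have h1 := hh Y hY.ne'
  have h2 := hh (-Y) (by linarith)
  rw [mlM_neg] at h2
  set a := ∫ x in σ..3, f (x + (-Y : ℝ) * Complex.I)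
  set b := ∫ x in σ..3, f (x + Y * Complex.I)
  set c := ∫ y in (-Y)..Y, f (((3:ℝ):ℂ) + y * Complex.I)
  set d := ∫ y in (-Y)..Y, f (σ + y * Complex.I)
  have : c = d + Complex.I * (a - b) := by
    simp only [smul_eq_mul] at hrect
    linear_combination (-Complex.I) * hrect + (c - d) * Complex.I_sq
  change ‖c‖ ≤ _
  rw [this]
  refine (norm_add_le _ _).trans ?_
  rw [norm_mul, Complex.norm_I, one_mul]
  have := norm_sub_le a b
  linarith

lemma ml_contour_lim {α β C : ℝ} (hα1 : 1 < α) (hα2 : α < 2) (hC0 : 0 ≤ C)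
    (hC : ∀ p : ℂ, 0 < p.re → p.re ≤ 3 → p.im ≠ 0 → ‖mlL α β p‖ ≤ C * mlM α p.im)
    {s : ℝ} (hs : 0 < s) :
    ‖∫ y : ℝ, Complex.exp ((((3:ℝ):ℂ) + y * Complex.I) * s) * mlL α β (((3:ℝ):ℂ) + y * Complex.I)‖ ≤
      C * ∫ y, mlM α y := by
  have hσ : ∀ σ : ℝ, 0 < σ → σ ≤ 3 → ‖∫ y : ℝ, Complex.exp ((((3:ℝ):ℂ) + y * Complex.I) * s) * mlL α β (((3:ℝ):ℂ) + y * Complex.I)‖ ≤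
      Real.exp (σ * s) * (C * ∫ y, mlM α y) := by
    intro σ h0 h3
    have ht := (intervalIntegral_tendsto_integral (ml_line_integrable hα1 hα2 hC s (by norm_num) le_rfl)
      tendsto_neg_atTop_atBot tendsto_id).norm
    have ht2 := (((((mlM_tendsto hα2).const_mul C).const_mul (Real.exp (3 * s))).const_mul 6).const_add
      (Real.exp (σ * s) * (C * ∫ y, mlM α y)))
    simp only [mul_zero, add_zero] at ht2
    refine le_of_tendsto_of_tendsto ht ht2 ?_
    filter_upwards [eventually_gt_atTop 0] with Y hY
    exact ml_contour hα1 hα2 hC0 hC hs h0 h3 hY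
  have ht : Tendsto (fun σ : ℝ => Real.exp (σ * s) * (C * ∫ y, mlM α y)) (𝓝[>] 0) (𝓝 (Real.exp (0 * s) * (C * ∫ y, mlM α y))) := by
    refine Tendsto.mono_left ?_ nhdsWithin_le_nhds
    exact Continuous.tendsto (by fun_prop) 0
  rw [zero_mul, Real.exp_zero, one_mul] at ht
  refine ge_of_tendsto ht ?_
  filter_upwards [Ioc_mem_nhdsGT (by norm_num : (0:ℝ) < 3)] with σ h
  exact hσ σ h.1 h.2

lemma ml_inversion {α β C : ℝ} (hα1 : 1 < α) (hα2 : α < 2) (hβ0 : 0 < β)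
    (hC : ∀ p : ℂ, 0 < p.re → p.re ≤ 3 → p.im ≠ 0 → ‖mlL α β p‖ ≤ C * mlM α p.im)
    {s : ℝ} (hs : 0 < s) :
    mlk α β s = (2 * Real.pi : ℝ)⁻¹ * ∫ y : ℝ, Complex.exp ((((3:ℝ):ℂ) + y * Complex.I) * s) * mlL α β (((3:ℝ):ℂ) + y * Complex.I) := by
  have hα : 0 < α := by linarith
  have hpi := Real.pi_pos
  set d : ℝ → ℂ := (Ioi (0:ℝ)).indicator (fun s : ℝ => mlk α β s * Complex.exp (-(((3:ℝ):ℂ) * s))) with hd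
  have hdi : Integrable d := by
    rw [hd, integrable_indicator_iff measurableSet_Ioi]
    exact mlk_integrable hα hβ0 (by simp)
  have hdc : ContinuousAt d s := by
    have h1 : ContinuousAt (fun s : ℝ => mlk α β s * Complex.exp (-(((3:ℝ):ℂ) * s))) s :=
      ((mlk_continuousOn hα hβ0).continuousAt (Ioi_mem_nhds hs)).mul (Continuous.continuousAt (by fun_prop))
    refine h1.congr ?_
    filter_upwards [Ioi_mem_nhds hs] with x hx
    rw [hd, indicator_of_mem hx]
  have hF : FourierTransform.fourier d = fun ξ : ℝ => mlL α β (((3:ℝ):ℂ) + ((2 * Real.pi * ξ : ℝ):ℂ) * Complex.I) := by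
    ext ξ
    rw [Real.fourier_eq', ← mlk_laplace hα hβ0 (p := ((3:ℝ):ℂ) + ((2 * Real.pi * ξ : ℝ):ℂ) * Complex.I) (by simp),
      ← integral_indicator measurableSet_Ioi]
    congr 1; ext x
    by_cases hx : x ∈ Ioi (0:ℝ)
    · rw [hd, indicator_of_mem hx, indicator_of_mem hx, smul_eq_mul, mul_left_comm, ← Complex.exp_add]
      congr 2
      simp
      ring
    · rw [hd, indicator_of_notMem hx, indicator_of_notMem hx, smul_zero]
  have hLi : Integrable (fun y : ℝ => mlL α β (((3:ℝ):ℂ) + (y:ℂ) * Complex.I)) := by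
    have := ml_line_integrable hα1 hα2 hC 0 (by norm_num) le_rfl
    simpa using this
  have hFi : Integrable (FourierTransform.fourier d) := by
    rw [hF]
    exact hLi.comp_mul_left' (R := 2 * Real.pi) (by positivity)
  have hinv := hdi.fourierInv_fourier_eq hFi hdc
  rw [Real.fourierInv_eq', hF, hd, indicator_of_mem (show s ∈ Ioi (0:ℝ) from hs)] at hinv
  have hsub := Measure.integral_comp_mul_left (fun y : ℝ => Complex.exp ((y * Complex.I) * s) * mlL α β (((3:ℝ):ℂ) + (y:ℂ) * Complex.I)) (2 * Real.pi)
  have h1 : mlk α β s * Complex.exp (-(((3:ℝ):ℂ) * s)) = (2 * Real.pi : ℝ)⁻¹ * ∫ y : ℝ, Complex.exp ((y * Complex.I) * s) * mlL α β (((3:ℝ):ℂ) + (y:ℂ) * Complex.I) := by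
    rw [← hinv]
    rw [abs_of_pos (by positivity), Complex.real_smul] at hsub
    rw [← hsub]
    congr 1; ext x
    rw [smul_eq_mul]
    congr 2
    simp
    ring
  have h2 : mlk α β s = Complex.exp (((3:ℝ):ℂ) * s) * (mlk α β s * Complex.exp (-(((3:ℝ):ℂ) * s))) := by
    rw [mul_left_comm, ← Complex.exp_add]; simp
  rw [h2, h1, mul_left_comm, ← integral_const_mul]
  congr 2; ext y
  rw [← mul_assoc, ← Complex.exp_add]
  congr 2; ring

lemma mlk_bounded {α β : ℝ} (hα1 : 1 < α) (hα2 : α < 2) (hβ0 : 0 < β) (hβ : 2 - α ≤ β) (hβ' : β ≤ 1 ∨ β = α) :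
    ∃ C : ℝ, 0 < C ∧ ∀ s : ℝ, 0 < s → ‖mlk α β s‖ ≤ C := by
  obtain ⟨C, hC0, hC⟩ := mlL_bound hα1 hα2 hβ0 hβ hβ'
  refine ⟨(2 * Real.pi)⁻¹ * (C * ∫ y, mlM α y) + 1, ?_, fun s hs => ?_⟩
  · have : 0 ≤ ∫ y, mlM α y := integral_nonneg (mlM_nonneg α)
    have := Real.pi_pos
    positivity
  · rw [ml_inversion hα1 hα2 hβ0 hC hs, norm_mul]
    have h1 := ml_contour_lim hα1 hα2 hC0 hC hs
    have hpi := Real.pi_pos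
    have e : ‖(((2 * Real.pi : ℝ)⁻¹ : ℝ) : ℂ)‖ = (2 * Real.pi)⁻¹ := by
      rw [Complex.norm_real, Real.norm_eq_abs, abs_of_pos (by positivity)]
    rw [e]
    have : (2 * Real.pi)⁻¹ * ‖∫ y : ℝ, Complex.exp ((((3:ℝ):ℂ) + y * Complex.I) * s) * mlL α β (((3:ℝ):ℂ) + y * Complex.I)‖ ≤ (2 * Real.pi)⁻¹ * (C * ∫ y, mlM α y) := by
      gcongr
    linarith

lemma psiML_eq (α t : ℝ) : psiML α t = mlE α 1 (mlc α * t) ^ 2 -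
    mlc α * t * mlE α 2 (mlc α * t) * mlE α α (mlc α * t) := rfl

lemma mlk_rearr {α β s : ℝ} : ((s ^ β : ℝ) : ℂ) * mlE α β (mlc α * ((s ^ α : ℝ) : ℂ)) =
    mlA α β * (s * Complex.exp (-(Complex.I * s))) + mlk α β s := by
  unfold mlk mlh; ring

lemma mlA_norm {α β : ℝ} (hα : 0 < α) : ‖mlA α β‖ = 1 / α := by
  unfold mlA
  rw [norm_div, Complex.norm_cpow_real, norm_neg, Complex.norm_I, Real.one_rpow, Complex.norm_real,
    Real.norm_eq_abs, abs_of_pos hα]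

lemma mlA_mul {α : ℝ} : mlA α (2 - α) * mlA α α = mlA α 1 ^ 2 := by
  unfold mlA
  have h : (-Complex.I) ^ ((1 - (2 - α) : ℝ) : ℂ) * (-Complex.I) ^ ((1 - α : ℝ) : ℂ) = 1 := by
    rw [← Complex.cpow_add _ _ (by simp)]
    have : ((1 - (2 - α) : ℝ) : ℂ) + ((1 - α : ℝ) : ℂ) = 0 := by push_cast; ring
    rw [this, Complex.cpow_zero]
  rw [div_mul_div_comm, h]
  simp
  ring

lemma psi_key {α : ℝ} (hα1 : 1 < α) (hα2 : α < 2) : ∃ D : ℝ, ∀ s : ℝ, 1 ≤ s →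
    ‖(s:ℂ) ^ 2 * psiML α (s ^ α) - 1 / Complex.Gamma ((2 - α : ℝ) : ℂ) * mlA α α *
      ((s ^ (3 - α) : ℝ) : ℂ) * Complex.exp (-(Complex.I * s))‖ ≤ D * s := by
  obtain ⟨C1, hC1, h1⟩ := mlk_bounded (β := 1) hα1 hα2 (by norm_num) (by linarith) (Or.inl le_rfl)
  obtain ⟨C2, hC2, h2⟩ := mlk_bounded (β := 2 - α) hα1 hα2 (by linarith) le_rfl (Or.inl (by linarith))
  obtain ⟨C3, hC3, h3⟩ := mlk_bounded (β := α) hα1 hα2 (by linarith) (by linarith) (Or.inr rfl)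
  refine ⟨2 * ‖mlA α 1‖ * C1 + C1 ^ 2 + (‖mlA α (2 - α)‖ * C3 + ‖mlA α α‖ * C2) + C2 * C3 +
    ‖1 / Complex.Gamma ((2 - α : ℝ) : ℂ)‖ * C3, fun s hs => ?_⟩
  have hs0 : 0 < s := by linarith
  replace h1 := h1 s hs0
  replace h2 := h2 s hs0
  replace h3 := h3 s hs0
  have r1 := mlk_rearr (α := α) (β := 1) (s := s)
  have r2 := mlk_rearr (α := α) (β := 2 - α) (s := s)
  have r3 := mlk_rearr (α := α) (β := α) (s := s)
  have hsh := ml_shift (α := α) (β := 2 - α) (by linarith) (by linarith) (mlc α * ((s ^ α : ℝ) : ℂ))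
  rw [sub_add_cancel] at hsh
  have hA := mlA_mul (α := α)
  rw [psiML_eq]
  have he : ‖Complex.exp (-(Complex.I * s))‖ = 1 := by
    rw [Complex.norm_exp]; simp
  set e := Complex.exp (-(Complex.I * s))
  set G := 1 / Complex.Gamma ((2 - α : ℝ) : ℂ)
  set z := mlc α * ((s ^ α : ℝ) : ℂ)
  set E1 := mlE α 1 z
  set E2 := mlE α (2 - α) z
  set E3 := mlE α α z
  set k1 := mlk α 1 s
  set k2 := mlk α (2 - α) s
  set k3 := mlk α α s
  rw [Real.rpow_one] at r1
  have p1 : ((s ^ (2 - α) : ℝ) : ℂ) * ((s ^ α : ℝ) : ℂ) = (s:ℂ) ^ 2 := by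
    rw [← Complex.ofReal_mul, ← Real.rpow_add hs0, sub_add_cancel]
    norm_cast
  have p2 : ((s ^ (3 - α) : ℝ) : ℂ) = ((s ^ (2 - α) : ℝ) : ℂ) * s := by
    rw [← Complex.ofReal_mul, ← Real.rpow_add_one hs0.ne']
    congr 2; ring
  have hu : ‖((s ^ (2 - α) : ℝ) : ℂ)‖ ≤ s := by
    rw [Complex.norm_real, Real.norm_eq_abs, abs_of_pos (by positivity)]
    calc s ^ (2 - α) ≤ s ^ (1:ℝ) := Real.rpow_le_rpow_of_exponent_le hs (by linarith)
      _ = s := Real.rpow_one s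
  have hsn : ‖(s:ℂ)‖ = s := by rw [Complex.norm_real, Real.norm_eq_abs, abs_of_pos hs0]
  rw [p2]
  set u := ((s ^ (2 - α) : ℝ) : ℂ)
  set v := ((s ^ α : ℝ) : ℂ)
  have hmain : (s:ℂ) ^ 2 * (E1 ^ 2 - z * mlE α 2 z * E3) - G * mlA α α * (u * s) * e =
      2 * mlA α 1 * (s * e) * k1 + k1 ^ 2 - (s * e) * (mlA α (2 - α) * k3 + mlA α α * k2) - k2 * k3 + G * (u * k3) := by
    have q1 : (s:ℂ) ^ 2 * E1 ^ 2 = (mlA α 1 * (s * e) + k1) ^ 2 := by rw [← r1]; ring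
    have q2 : (s:ℂ) ^ 2 * (E2 * E3) = (mlA α (2 - α) * (s * e) + k2) * (mlA α α * (s * e) + k3) := by
      rw [← r2, ← r3, ← p1]; ring
    have q3 : (s:ℂ) ^ 2 * E3 = u * (mlA α α * (s * e) + k3) := by rw [← r3, ← p1]; ring
    have q4 : z * mlE α 2 z = E2 - G := by rw [hsh]; ring
    rw [q4]
    linear_combination q1 - q2 + G * q3 - (s * e) ^ 2 * hA
  rw [hmain]
  have b1 : ‖2 * mlA α 1 * (s * e) * k1‖ ≤ 2 * ‖mlA α 1‖ * C1 * s := by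
    rw [norm_mul, norm_mul, norm_mul, norm_mul, he, hsn]
    simp only [Complex.norm_ofNat, mul_one]
    calc _ ≤ 2 * ‖mlA α 1‖ * s * C1 := by gcongr
      _ = _ := by ring
  have b2 : ‖k1 ^ 2‖ ≤ C1 ^ 2 * s := by
    rw [norm_pow]
    calc _ ≤ C1 ^ 2 * 1 := by rw [mul_one]; gcongr
      _ ≤ _ := by gcongr
  have b3 : ‖(s * e) * (mlA α (2 - α) * k3 + mlA α α * k2)‖ ≤ (‖mlA α (2 - α)‖ * C3 + ‖mlA α α‖ * C2) * s := by
    rw [norm_mul, norm_mul, he, hsn, mul_one, mul_comm]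
    gcongr
    refine (norm_add_le _ _).trans ?_
    rw [norm_mul, norm_mul]
    gcongr
  have b4 : ‖k2 * k3‖ ≤ C2 * C3 * s := by
    rw [norm_mul]
    calc _ ≤ C2 * C3 * 1 := by rw [mul_one]; gcongr
      _ ≤ _ := by gcongr
  have b5 : ‖G * (u * k3)‖ ≤ ‖G‖ * C3 * s := by
    rw [norm_mul, norm_mul]
    calc _ ≤ ‖G‖ * (s * C3) := by gcongr
      _ = _ := by ring
  have t1 := norm_add_le (2 * mlA α 1 * (s * e) * k1 + k1 ^ 2 - (s * e) * (mlA α (2 - α) * k3 + mlA α α * k2) - k2 * k3) (G * (u * k3))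
  have t2 := norm_sub_le (2 * mlA α 1 * (s * e) * k1 + k1 ^ 2 - (s * e) * (mlA α (2 - α) * k3 + mlA α α * k2)) (k2 * k3)
  have t3 := norm_sub_le (2 * mlA α 1 * (s * e) * k1 + k1 ^ 2) ((s * e) * (mlA α (2 - α) * k3 + mlA α α * k2))
  have t4 := norm_add_le (2 * mlA α 1 * (s * e) * k1) (k1 ^ 2)
  linarith

lemma psi_eventually {α : ℝ} (hα1 : 1 < α) (hα2 : α < 2) :
    ∃ R : ℝ, 0 < R ∧ ∀ t : ℝ, R < t → psiML α t ≠ 0 := by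
  obtain ⟨D, hD⟩ := psi_key hα1 hα2
  have hα : 0 < α := by linarith
  set g := Real.Gamma (2 - α) with hg
  have hgp : 0 < g := Real.Gamma_pos_of_pos (by linarith)
  have ht := tendsto_rpow_atTop (y := 2 - α) (by linarith)
  obtain ⟨S, hS⟩ := (ht.eventually (eventually_gt_atTop (D * α * g))).exists_forall_of_atTop
  refine ⟨(max S 1) ^ α, by positivity, fun t htR h0 => ?_⟩
  have hm : 0 < max S 1 := by positivity
  have ht0 : 0 < t := lt_trans (by positivity) htR
  set s := t ^ (1 / α) with hs
  have hst : s ^ α = t := by rw [hs, ← Real.rpow_mul ht0.le]; simp [hα.ne']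
  have hsm : max S 1 < s := by
    rw [← hst] at htR
    exact (Real.rpow_lt_rpow_iff hm.le (by positivity) hα).1 htR
  have hs1 : 1 ≤ s := (le_max_right S 1).trans hsm.le
  have hs0 : 0 < s := by linarith
  have h1 := hD s hs1
  have h2 := hS s ((le_max_left S 1).trans hsm.le)
  rw [hst, h0, mul_zero, zero_sub, norm_neg, norm_mul, norm_mul, norm_mul, norm_div, norm_one,
    ml_norm_Gamma (by linarith), mlA_norm hα, Complex.norm_exp, Complex.norm_real, Real.norm_eq_abs,
    abs_of_pos (by positivity)] at h1
  have e1 : (-(Complex.I * (s:ℂ))).re = 0 := by simp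
  rw [e1, Real.exp_zero, mul_one, ← hg] at h1
  have e2 : s ^ (3 - α) = s ^ (2 - α) * s := by
    rw [← Real.rpow_add_one hs0.ne']; congr 1; ring
  rw [e2, ← mul_assoc] at h1
  have h3 := le_of_mul_le_mul_right h1 hs0
  have h4 : 1 / g * (1 / α) * s ^ (2 - α) = s ^ (2 - α) / (α * g) := by field_simp
  rw [h4, div_le_iff₀ (by positivity)] at h3
  linarith

lemma psi_analytic {α : ℝ} (hα : 0 < α) : AnalyticOnNhd ℝ (psiML α) univ := by
  intro t _
  have hE : ∀ β : ℝ, 0 < β → AnalyticAt ℝ (fun t : ℝ => mlE α β (mlc α * t)) t := by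
    intro β hβ
    have hd : Differentiable ℂ (fun z : ℂ => mlE α β (mlc α * z)) :=
      (ml_differentiable hα hβ).comp (by fun_prop)
    have h1 : AnalyticAt ℝ (fun z : ℂ => mlE α β (mlc α * z)) ((t:ℝ):ℂ) :=
      (hd.analyticAt _).restrictScalars
    exact AnalyticAt.comp (f := fun t : ℝ => (t:ℂ)) h1 (Complex.ofRealCLM.analyticAt t)
  have h0 : AnalyticAt ℝ (fun t : ℝ => mlc α * (t:ℂ)) t :=
    analyticAt_const.mul (Complex.ofRealCLM.analyticAt t)
  exact ((hE 1 (by norm_num)).pow 2).sub ((h0.mul (hE 2 (by norm_num))).mul (hE α hα))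

theorem psi_eventually_nonzero_and_finite_zeros (α : ℝ) (hα1 : 1 < α) (hα2 : α < 2) :
    (∃ R : ℝ, 0 < R ∧ ∀ t : ℝ, R < t → psiML α t ≠ 0) ∧
    {t : ℝ | 0 < t ∧ psiML α t = 0}.Finite := by
  have hev := psi_eventually hα1 hα2
  refine ⟨hev, ?_⟩
  obtain ⟨R, hR, h⟩ := hev
  by_contra hinf
  have hsub : {t : ℝ | 0 < t ∧ psiML α t = 0} ⊆ Icc 0 R := by
    rintro t ⟨h1, h2⟩
    exact ⟨h1.le, not_lt.1 fun h3 => h t h3 h2⟩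
  obtain ⟨x, -, hx⟩ := Set.Infinite.exists_accPt_of_subset_isCompact hinf isCompact_Icc hsub
  have hf : ∃ᶠ t in 𝓝[≠] x, psiML α t = 0 := by
    rw [accPt_iff_frequently_nhdsNE] at hx
    exact hx.mono fun t ht => ht.2
  have hz := (psi_analytic (by linarith : 0 < α)).eqOn_zero_of_preconnected_of_frequently_eq_zero
    isPreconnected_univ (mem_univ x) hf (mem_univ 0)
  rw [psiML_eq] at hz
  simp [ml_zero] at hz
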